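/- (Partition function shift for the generalised exponential zero range process.) Let 𝔞, β > 0, 𝔟 ≥ 0, and g(z) = 𝔞·e^{βz} + 𝔟 on ℤ. Let σ ∈ ℝ with e^{σ} > 𝔟. Then Z(σ) := Σ_{z∈ℤ} e^{σz}/g(z)! and Z(σ+β) are finite, the series Σ_{z∈ℤ} g(z)·e^{σz}/g(z)! converges and equals e^{σ}·Z(σ), and Z(σ+β) = Z(σ)·(e^{σ} − 𝔟)/𝔞. -/

import Mathlib

open Real

noncomputable def gfactZ (g : ℤ → ℝ) (z : ℤ) : ℝ :=
  if 0 ≤ z then ∏ y ∈ Finset.Icc 1 z, g y else (∏ y ∈ Finset.Icc (z + 1) 0, g y)⁻¹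

noncomputable def ZZ (g : ℤ → ℝ) (θ : ℝ) : ℝ := ∑' z : ℤ, exp (θ * z) / gfactZ g z

noncomputable def muZ (g : ℤ → ℝ) (θ : ℝ) (z : ℤ) : ℝ := exp (θ * z) / (gfactZ g z * ZZ g θ)

theorem gfactZ_pos (g : ℤ → ℝ) (hg : ∀ z, 0 < g z) (z : ℤ) : 0 < gfactZ g z := by
  unfold gfactZ
  split_ifs
  · exact Finset.prod_pos fun i _ => hg i
  · exact inv_pos.mpr (Finset.prod_pos fun i _ => hg i)

theorem gfactZ_rec (g : ℤ → ℝ) (hg : ∀ z, 0 < g z) (z : ℤ) :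
    gfactZ g z = g z * gfactZ g (z - 1) := by
  unfold gfactZ
  rcases lt_trichotomy z 0 with h | h | h
  · rw [if_neg (by omega), if_neg (by omega)]
    have e : Finset.Icc (z - 1 + 1) 0 = insert z (Finset.Icc (z + 1) 0) := by
      ext x; simp only [Finset.mem_Icc, Finset.mem_insert]; omega
    rw [e, Finset.prod_insert (by simp), mul_inv, ← mul_assoc,
      mul_inv_cancel₀ (hg z).ne', one_mul]
  · subst h
    have := (hg 0).ne'
    simp [this]
  · rw [if_pos (by omega), if_pos (by omega)]
    have e : Finset.Icc 1 z = insert z (Finset.Icc 1 (z - 1)) := by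
      ext x; simp only [Finset.mem_Icc, Finset.mem_insert]; omega
    rw [e, Finset.prod_insert (by simp)]

theorem term_rec (g : ℤ → ℝ) (hg : ∀ z, 0 < g z) (θ : ℝ) (z : ℤ) :
    g z * exp (θ * z) / gfactZ g z = exp θ * (exp (θ * ((z - 1 : ℤ) : ℝ)) / gfactZ g (z - 1)) := by
  have h1 := (gfactZ_pos g hg (z - 1)).ne'
  have h2 := (hg z).ne'
  have e : exp (θ * z) = exp θ * exp (θ * ((z - 1 : ℤ) : ℝ)) := by
    rw [← exp_add]; congr 1; push_cast; ring
  rw [gfactZ_rec g hg z, e]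
  field_simp

theorem summable_term (𝔞 β 𝔟 θ : ℝ) (h𝔞 : 0 < 𝔞) (hβ : 0 < β) (h𝔟 : 0 ≤ 𝔟)
    (hθ : 𝔟 < exp θ) (g : ℤ → ℝ) (hg : ∀ z : ℤ, g z = 𝔞 * exp (β * z) + 𝔟) :
    Summable fun z : ℤ => exp (θ * z) / gfactZ g z := by
  have hpos : ∀ z, 0 < g z := fun z => by rw [hg]; positivity
  set f : ℤ → ℝ := fun z : ℤ => exp (θ * z) / gfactZ g z with hf
  have fpos : ∀ z, 0 < f z := fun z => div_pos (exp_pos _) (gfactZ_pos g hpos z)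
  have frec : ∀ z, g z * f z = exp θ * f (z - 1) := fun z => by
    have := term_rec g hpos θ z
    rw [← this, hf]; simp only; ring
  have T : Filter.Tendsto (fun n : ℕ => β * (n : ℝ)) Filter.atTop Filter.atTop :=
    tendsto_natCast_atTop_atTop.const_mul_atTop hβ
  apply Summable.of_nat_of_neg
  · apply summable_of_ratio_test_tendsto_lt_one (l := 0) one_pos
    · exact Filter.Eventually.of_forall fun n => (fpos _).ne'
    · have e : ∀ n : ℕ, ‖f ((n + 1 : ℕ) : ℤ)‖ / ‖f (n : ℤ)‖ = exp θ / g ((n + 1 : ℕ) : ℤ) := by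
        intro n
        rw [Real.norm_of_nonneg (fpos _).le, Real.norm_of_nonneg (fpos _).le,
          div_eq_div_iff (fpos _).ne' (hpos _).ne']
        have := frec ((n + 1 : ℕ) : ℤ)
        rw [show (((n + 1 : ℕ) : ℤ) - 1) = (n : ℤ) by push_cast; ring] at this
        linarith
      simp_rw [e]
      apply Filter.Tendsto.const_div_atTop
      have := (Filter.tendsto_add_atTop_iff_nat 1).mpr
        (Filter.tendsto_atTop_add_const_right _ 𝔟
          ((tendsto_exp_atTop.comp T).const_mul_atTop h𝔞))
      refine this.congr fun n => ?_
      rw [hg]; simp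
  · apply summable_of_ratio_test_tendsto_lt_one (l := (𝔞 * 0 + 𝔟) / exp θ)
    · rw [div_lt_one (exp_pos _)]; simpa using hθ
    · exact Filter.Eventually.of_forall fun n => (fpos _).ne'
    · have e : ∀ n : ℕ, ‖f (-((n + 1 : ℕ) : ℤ))‖ / ‖f (-(n : ℤ))‖
          = (𝔞 * exp (-(β * (n : ℝ))) + 𝔟) / exp θ := by
        intro n
        rw [Real.norm_of_nonneg (fpos _).le, Real.norm_of_nonneg (fpos _).le,
          div_eq_div_iff (fpos _).ne' (exp_pos _).ne']
        have := frec (-(n : ℤ))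
        rw [show (-(n : ℤ) - 1) = -((n + 1 : ℕ) : ℤ) by push_cast; ring, hg] at this
        push_cast at this ⊢
        rw [mul_neg] at this
        linarith
      simp_rw [e]
      exact (((tendsto_exp_neg_atTop_nhds_zero.comp T).const_mul 𝔞).add_const 𝔟).div_const _

/-- Partition function shift for the generalised exponential zero range process:
for `g(z) = 𝔞·e^{βz} + 𝔟` and `e^σ > 𝔟`, the partition functions `Z(σ)` and `Z(σ+β)`
are finite, `∑ g(z)·e^{σz}/g(z)! = e^σ·Z(σ)`, and `Z(σ+β) = Z(σ)·(e^σ - 𝔟)/𝔞`. -/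
theorem partition_function_shift_generalised_exponential
    (𝔞 β 𝔟 σ : ℝ) (h𝔞 : 0 < 𝔞) (hβ : 0 < β) (h𝔟 : 0 ≤ 𝔟)
    (hσ : 𝔟 < exp σ)
    (g : ℤ → ℝ) (hg : ∀ z : ℤ, g z = 𝔞 * exp (β * z) + 𝔟) :
    (Summable fun z : ℤ => exp (σ * z) / gfactZ g z) ∧
    (Summable fun z : ℤ => exp ((σ + β) * z) / gfactZ g z) ∧
    (Summable fun z : ℤ => g z * exp (σ * z) / gfactZ g z) ∧
    (∑' z : ℤ, g z * exp (σ * z) / gfactZ g z) = exp σ * ZZ g σ ∧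
    ZZ g (σ + β) = ZZ g σ * (exp σ - 𝔟) / 𝔞 := by
  have hpos : ∀ z, 0 < g z := fun z => by rw [hg]; positivity
  have s1 := summable_term 𝔞 β 𝔟 σ h𝔞 hβ h𝔟 hσ g hg
  have s2 := summable_term 𝔞 β 𝔟 (σ + β) h𝔞 hβ h𝔟
    (hσ.trans (exp_lt_exp.mpr (by linarith))) g hg
  have s3 : HasSum (fun z : ℤ => g z * exp (σ * z) / gfactZ g z) (exp σ * ZZ g σ) := by
    have h := ((Equiv.subRight (1 : ℤ)).hasSum_iff.mpr s1.hasSum).mul_left (exp σ)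
    have e : (fun z : ℤ => g z * exp (σ * z) / gfactZ g z) = fun z : ℤ => exp σ *
        ((fun z : ℤ => exp (σ * z) / gfactZ g z) ∘ (Equiv.subRight (1 : ℤ))) z := by
      funext z
      exact term_rec g hpos σ z
    rw [e]
    exact h
  refine ⟨s1, s2, s3.summable, s3.tsum_eq, ?_⟩
  have h4 := s3.sub (s1.hasSum.mul_left 𝔟)
  have h5 : HasSum (fun z : ℤ => g z * exp (σ * z) / gfactZ g z
      - 𝔟 * (exp (σ * z) / gfactZ g z)) (𝔞 * ZZ g (σ + β)) := by
    have h := s2.hasSum.mul_left 𝔞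
    have e : (fun z : ℤ => g z * exp (σ * z) / gfactZ g z - 𝔟 * (exp (σ * z) / gfactZ g z))
        = fun z : ℤ => 𝔞 * (exp ((σ + β) * z) / gfactZ g z) := by
      funext z
      rw [add_mul, exp_add, hg]
      ring
    rw [e]
    exact h
  have h6 := h4.unique h5
  rw [eq_div_iff h𝔞.ne']
  unfold ZZ at *
  linarith
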